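/- Let R be a ring, let (C_i, d_i), i ∈ ℕ, be a sequence of differential R-modules, and let κ_i : C_i → C_{i+1} be chain maps. Let (T, D) be the associated telescope. Then D ∘ D = 0, and the homology H(T, D) = ker D ⧸ range D is isomorphic as an R-module to the direct limit colim_i H(C_i, d_i) of the homologies taken along the maps H(C_i, d_i) → H(C_{i+1}, d_{i+1}) induced by κ_i; the isomorphism is induced by the inclusions of C_i into the first direct summand of T. -/

import Mathlib

open DirectSum

section Telescope

variable {R : Type*} [Ring R]

/-- The homology of a differential module `(A, dA)`: `ker dA ⧸ range dA`. -/
abbrev homologyOf {A : Type*} [AddCommGroup A] [Module R A] (dA : A →ₗ[R] A) :=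
  LinearMap.ker dA ⧸ (LinearMap.range dA).comap (LinearMap.ker dA).subtype

/-- A chain map restricts to a map of cycles. -/
def cyclesMap {A B : Type*} [AddCommGroup A] [Module R A] [AddCommGroup B] [Module R B]
    (dA : A →ₗ[R] A) (dB : B →ₗ[R] B) (g : A →ₗ[R] B)
    (hg : g ∘ₗ dA = dB ∘ₗ g) :
    LinearMap.ker dA →ₗ[R] LinearMap.ker dB :=
  g.restrict (p := LinearMap.ker dA) (q := LinearMap.ker dB) (fun x hx => by
    have hgx := LinearMap.congr_fun hg x
    simp only [LinearMap.comp_apply] at hgx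
    simp only [LinearMap.mem_ker] at hx ⊢
    rw [← hgx, hx, map_zero])

/-- The map induced on homology by a chain map. -/
def inducedHom {A B : Type*} [AddCommGroup A] [Module R A] [AddCommGroup B] [Module R B]
    (dA : A →ₗ[R] A) (dB : B →ₗ[R] B) (g : A →ₗ[R] B)
    (hg : g ∘ₗ dA = dB ∘ₗ g) :
    homologyOf dA →ₗ[R] homologyOf dB :=
  Submodule.mapQ _ _ (cyclesMap dA dB g hg) (by
    rintro ⟨x, hx⟩ hmem
    rw [Submodule.mem_comap] at hmem ⊢
    obtain ⟨y, hy⟩ := hmem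
    refine ⟨g y, ?_⟩
    have hgy := LinearMap.congr_fun hg y
    simp only [LinearMap.comp_apply] at hgy
    have hcoe : ((cyclesMap dA dB g hg ⟨x, hx⟩ : LinearMap.ker dB) : B) = g x :=
      LinearMap.restrict_coe_apply _ _ _
    show dB (g y) = _
    rw [← hgy]
    simp only [Submodule.coe_subtype]
    rw [hcoe]
    exact congrArg g hy)

variable (C : ℕ → Type*) [∀ i, AddCommGroup (C i)] [∀ i, Module R (C i)]

/-- Componentwise differential on the direct sum. -/
def dSum (d : ∀ i, C i →ₗ[R] C i) : (⨁ i, C i) →ₗ[R] ⨁ i, C i :=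
  DirectSum.toModule R ℕ _ (fun i => (DirectSum.lof R ℕ C (i)).comp (d i))

/-- Shift map of the telescope: sends the summand `C i` to `C (i+1)` via `κ i`. -/
def shiftSum (κ : ∀ i, C i →ₗ[R] C (i + 1)) : (⨁ i, C i) →ₗ[R] ⨁ i, C i :=
  DirectSum.toModule R ℕ _ (fun i => (DirectSum.lof R ℕ C (i + 1)).comp (κ i))

/-- The connecting map `c` of the telescope: `(c b)₀ = −b₀`,
`(c b)_{i+1} = κ_i (b_i) − b_{i+1}`. -/
def conn (κ : ∀ i, C i →ₗ[R] C (i + 1)) : (⨁ i, C i) →ₗ[R] ⨁ i, C i :=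
  shiftSum C κ - LinearMap.id

/-- The telescope differential `D (a, b) = (d a + c b, −d b)`. -/
def Dtel (d : ∀ i, C i →ₗ[R] C i) (κ : ∀ i, C i →ₗ[R] C (i + 1)) :
    ((⨁ i, C i) × ⨁ i, C i) →ₗ[R] (⨁ i, C i) × ⨁ i, C i :=
  LinearMap.prod
    ((dSum C d).comp (LinearMap.fst R _ _) + (conn C κ).comp (LinearMap.snd R _ _))
    (-(dSum C d).comp (LinearMap.snd R _ _))

/-- The inclusion of `C i` into the first direct summand of the telescope. -/
def iota (i : ℕ) : C i →ₗ[R] (⨁ i, C i) × ⨁ i, C i :=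
  LinearMap.prod (DirectSum.lof R ℕ C i) 0

/-- The inclusions `C i → T` are chain maps. -/
lemma iota_chain (d : ∀ i, C i →ₗ[R] C i) (κ : ∀ i, C i →ₗ[R] C (i + 1)) (i : ℕ) :
    (iota C i) ∘ₗ (d i) = (Dtel C d κ) ∘ₗ (iota C i) := by
  refine LinearMap.ext fun x => ?_
  apply Prod.ext <;>
    simp [iota, Dtel, dSum, conn, shiftSum, DirectSum.toModule_lof]

/-- The directed system of homologies induced by the chain maps `κ`. -/
def fH (d : ∀ i, C i →ₗ[R] C i) (κ : ∀ i, C i →ₗ[R] C (i + 1))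
    (hκ : ∀ i, (κ i) ∘ₗ (d i) = (d (i + 1)) ∘ₗ (κ i))
    (i j : ℕ) (h : i ≤ j) : homologyOf (d i) →ₗ[R] homologyOf (d j) :=
  Nat.leRecOn h
    (fun {k} g => (inducedHom (d k) (d (k + 1)) (κ k) (hκ k)).comp g) LinearMap.id

section HomologyClass

variable {A B : Type*} [AddCommGroup A] [Module R A] [AddCommGroup B] [Module R B]

/-- The homology class of a cycle. -/
def homologyClass (dA : A →ₗ[R] A) (x : A) (hx : dA x = 0) : homologyOf dA :=
  Submodule.Quotient.mk ⟨x, hx⟩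

lemma exists_homologyClass_eq (dA : A →ₗ[R] A) (z : homologyOf dA) :
    ∃ x hx, homologyClass dA x hx = z := by
  obtain ⟨⟨x, hx⟩, rfl⟩ := Submodule.Quotient.mk_surjective _ z
  exact ⟨x, hx, rfl⟩

lemma homologyClass_eq_zero_iff (dA : A →ₗ[R] A) (x : A) (hx : dA x = 0) :
    homologyClass dA x hx = 0 ↔ ∃ y, dA y = x :=
  Submodule.Quotient.mk_eq_zero _

lemma homologyClass_eq_iff (dA : A →ₗ[R] A) (x y : A) (hx : dA x = 0) (hy : dA y = 0) :
    homologyClass dA x hx = homologyClass dA y hy ↔ ∃ z, dA z = x - y :=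
  Submodule.Quotient.eq _

lemma apply_eq_zero_of_chain {dA : A →ₗ[R] A} {dB : B →ₗ[R] B} {g : A →ₗ[R] B}
    (hg : g ∘ₗ dA = dB ∘ₗ g) {x : A} (hx : dA x = 0) : dB (g x) = 0 := by
  have h := LinearMap.congr_fun hg x
  simp only [LinearMap.comp_apply, hx, map_zero] at h
  exact h.symm

lemma inducedHom_homologyClass (dA : A →ₗ[R] A) (dB : B →ₗ[R] B) (g : A →ₗ[R] B)
    (hg : g ∘ₗ dA = dB ∘ₗ g) (x : A) (hx : dA x = 0) :
    inducedHom dA dB g hg (homologyClass dA x hx) =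
      homologyClass dB (g x) (apply_eq_zero_of_chain hg hx) :=
  rfl

end HomologyClass

section Components

variable {C}

lemma dSum_lof (d : ∀ i, C i →ₗ[R] C i) (i : ℕ) (x : C i) :
    dSum C d (lof R ℕ C i x) = lof R ℕ C i (d i x) := by
  simp [dSum, toModule_lof]

lemma conn_lof (κ : ∀ i, C i →ₗ[R] C (i + 1)) (i : ℕ) (x : C i) :
    conn C κ (lof R ℕ C i x) = lof R ℕ C (i + 1) (κ i x) - lof R ℕ C i x := by
  simp [conn, shiftSum, toModule_lof]

lemma component_lof_of_ne {i j : ℕ} (h : i ≠ j) (x : C i) :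
    component R ℕ C j (lof R ℕ C i x) = 0 := by
  rw [component.of, dif_neg h]

lemma component_dSum (d : ∀ i, C i →ₗ[R] C i) (n : ℕ) :
    component R ℕ C n ∘ₗ dSum C d = d n ∘ₗ component R ℕ C n := by
  refine linearMap_ext R fun i => LinearMap.ext fun x => ?_
  simp only [LinearMap.comp_apply, dSum_lof]
  by_cases h : i = n
  · subst h
    simp only [component.lof_self]
  · simp only [component_lof_of_ne h, map_zero]

lemma component_zero_conn (κ : ∀ i, C i →ₗ[R] C (i + 1)) :
    component R ℕ C 0 ∘ₗ conn C κ = -component R ℕ C 0 := by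
  refine linearMap_ext R fun i => LinearMap.ext fun x => ?_
  simp only [LinearMap.comp_apply, LinearMap.neg_apply, conn_lof, map_sub,
    component_lof_of_ne (Nat.succ_ne_zero i), zero_sub]

lemma component_succ_conn (κ : ∀ i, C i →ₗ[R] C (i + 1)) (n : ℕ) :
    component R ℕ C (n + 1) ∘ₗ conn C κ =
      κ n ∘ₗ component R ℕ C n - component R ℕ C (n + 1) := by
  refine linearMap_ext R fun i => LinearMap.ext fun x => ?_
  simp only [LinearMap.comp_apply, LinearMap.sub_apply, conn_lof, map_sub]
  by_cases h : i = n
  · subst h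
    simp only [component.lof_self]
  · have h' : i + 1 ≠ n + 1 := by omega
    simp only [component_lof_of_ne h, component_lof_of_ne h', map_zero]

lemma exists_component_eq_zero (a : ⨁ i, C i) :
    ∃ N, ∀ n, N ≤ n → component R ℕ C n a = 0 := by
  induction a using DirectSum.induction_on with
  | zero => exact ⟨0, fun n _ => map_zero _⟩
  | of i x =>
    refine ⟨i + 1, fun n hn => ?_⟩
    exact component_lof_of_ne (by omega) x
  | add a b ha hb =>
    obtain ⟨M, hM⟩ := ha
    obtain ⟨N, hN⟩ := hb
    refine ⟨max M N, fun n hn => ?_⟩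
    rw [map_add, hM n (by omega), hN n (by omega), add_zero]

lemma sum_lof_component (a : ⨁ i, C i) (N : ℕ)
    (h : ∀ n, N ≤ n → component R ℕ C n a = 0) :
    ∑ n ∈ Finset.range N, lof R ℕ C n (component R ℕ C n a) = a := by
  refine ext_component R fun k => ?_
  rw [map_sum]
  by_cases hk : k < N
  · rw [Finset.sum_eq_single_of_mem k (Finset.mem_range.2 hk)
      fun n _ hn => component_lof_of_ne hn _, component.lof_self]
  · rw [h k (by omega)]
    refine Finset.sum_eq_zero fun n hn => component_lof_of_ne ?_ _
    have := Finset.mem_range.1 hn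
    omega

end Components

section Push

variable {C}

/-- The map `⨁ C i → C n` which pushes the summands `C i` with `i ≤ n` forward to `C n` along
the maps `κ` and kills the others. -/
def pushTo (κ : ∀ i, C i →ₗ[R] C (i + 1)) : ∀ n, (⨁ i, C i) →ₗ[R] C n
  | 0 => component R ℕ C 0
  | n + 1 => κ n ∘ₗ pushTo κ n + component R ℕ C (n + 1)

variable (κ : ∀ i, C i →ₗ[R] C (i + 1))

lemma pushTo_succ (n : ℕ) (a : ⨁ i, C i) :
    pushTo κ (n + 1) a = κ n (pushTo κ n a) + component R ℕ C (n + 1) a :=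
  rfl

lemma pushTo_lof_of_lt {n i : ℕ} (h : n < i) (x : C i) :
    pushTo κ n (lof R ℕ C i x) = 0 := by
  induction n with
  | zero => exact component_lof_of_ne (by omega) x
  | succ n ih =>
    rw [pushTo_succ, ih (by omega), map_zero, zero_add, component_lof_of_ne (by omega)]

lemma pushTo_lof_self (i : ℕ) (x : C i) : pushTo κ i (lof R ℕ C i x) = x := by
  cases i with
  | zero => exact component.lof_self R 0 x
  | succ n =>
    rw [pushTo_succ, pushTo_lof_of_lt κ n.lt_succ_self, map_zero, zero_add, component.lof_self]

lemma pushTo_lof_succ {n i : ℕ} (h : i ≤ n) (x : C i) :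
    pushTo κ (n + 1) (lof R ℕ C i x) = κ n (pushTo κ n (lof R ℕ C i x)) := by
  rw [pushTo_succ, component_lof_of_ne (by omega), add_zero]

lemma pushTo_dSum (d : ∀ i, C i →ₗ[R] C i)
    (hκ : ∀ i, (κ i) ∘ₗ (d i) = (d (i + 1)) ∘ₗ (κ i)) (n : ℕ) :
    pushTo κ n ∘ₗ dSum C d = d n ∘ₗ pushTo κ n := by
  induction n with
  | zero => exact component_dSum d 0
  | succ n ih =>
    rw [pushTo, LinearMap.add_comp, LinearMap.comp_assoc, ih, component_dSum,
      ← LinearMap.comp_assoc, hκ, LinearMap.comp_assoc, LinearMap.comp_add]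

lemma pushTo_conn (n : ℕ) : pushTo κ n ∘ₗ conn C κ = -component R ℕ C n := by
  induction n with
  | zero => exact component_zero_conn κ
  | succ n ih =>
    rw [pushTo, LinearMap.add_comp, LinearMap.comp_assoc, ih, component_succ_conn,
      LinearMap.comp_neg]
    abel

lemma sum_lof_component_add_conn (a : ⨁ i, C i) (n : ℕ) :
    ∑ k ∈ Finset.range (n + 1), lof R ℕ C k (component R ℕ C k a) +
        conn C κ (∑ k ∈ Finset.range n, lof R ℕ C k (pushTo κ k a)) =
      lof R ℕ C n (pushTo κ n a) := by
  induction n with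
  | zero => simp [pushTo]
  | succ n ih =>
    rw [Finset.sum_range_succ, Finset.sum_range_succ (fun k => lof R ℕ C k (pushTo κ k a)),
      map_add, conn_lof, pushTo_succ, map_add, ← ih]
    abel

end Push

section TelescopeHomology

variable {C} {d : ∀ i, C i →ₗ[R] C i} {κ : ∀ i, C i →ₗ[R] C (i + 1)}

lemma Dtel_apply (a b : ⨁ i, C i) :
    Dtel C d κ (a, b) = (dSum C d a + conn C κ b, -dSum C d b) :=
  rfl

lemma dSum_comp_dSum (hd : ∀ i, (d i) ∘ₗ (d i) = 0) : dSum C d ∘ₗ dSum C d = 0 := by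
  refine linearMap_ext R fun i => LinearMap.ext fun x => ?_
  have h := LinearMap.congr_fun (hd i) x
  simp only [LinearMap.comp_apply, LinearMap.zero_apply] at h
  simp [dSum_lof, h]

lemma conn_comp_dSum (hκ : ∀ i, (κ i) ∘ₗ (d i) = (d (i + 1)) ∘ₗ (κ i)) :
    conn C κ ∘ₗ dSum C d = dSum C d ∘ₗ conn C κ := by
  refine linearMap_ext R fun i => LinearMap.ext fun x => ?_
  have h := LinearMap.congr_fun (hκ i) x
  simp only [LinearMap.comp_apply] at h
  simp [dSum_lof, conn_lof, h]

lemma Dtel_comp_Dtel (hd : ∀ i, (d i) ∘ₗ (d i) = 0)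
    (hκ : ∀ i, (κ i) ∘ₗ (d i) = (d (i + 1)) ∘ₗ (κ i)) :
    Dtel C d κ ∘ₗ Dtel C d κ = 0 := by
  refine LinearMap.ext fun ⟨a, b⟩ => ?_
  have h1 := LinearMap.congr_fun (dSum_comp_dSum hd)
  have h2 := LinearMap.congr_fun (conn_comp_dSum hκ) b
  simp only [LinearMap.comp_apply, LinearMap.zero_apply] at h1 h2
  simp [Dtel_apply, h1, h2]

lemma dSum_pushTo_lof (hκ : ∀ i, (κ i) ∘ₗ (d i) = (d (i + 1)) ∘ₗ (κ i))
    (n : ℕ) {i : ℕ} {x : C i} (hx : d i x = 0) : d n (pushTo κ n (lof R ℕ C i x)) = 0 :=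
  apply_eq_zero_of_chain (pushTo_dSum κ d hκ n) (by rw [dSum_lof, hx, map_zero])

lemma fH_self (hκ : ∀ i, (κ i) ∘ₗ (d i) = (d (i + 1)) ∘ₗ (κ i)) (i : ℕ) :
    fH C d κ hκ i i le_rfl = LinearMap.id :=
  Nat.leRecOn_self _

lemma fH_succ (hκ : ∀ i, (κ i) ∘ₗ (d i) = (d (i + 1)) ∘ₗ (κ i)) {i j : ℕ} (h : i ≤ j) :
    fH C d κ hκ i (j + 1) (h.trans j.le_succ) =
      inducedHom (d j) (d (j + 1)) (κ j) (hκ j) ∘ₗ fH C d κ hκ i j h :=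
  Nat.leRecOn_succ h _

lemma fH_homologyClass (hκ : ∀ i, (κ i) ∘ₗ (d i) = (d (i + 1)) ∘ₗ (κ i)) {i j : ℕ}
    (h : i ≤ j) (x : C i) (hx : d i x = 0) :
    fH C d κ hκ i j h (homologyClass (d i) x hx) =
      homologyClass (d j) (pushTo κ j (lof R ℕ C i x)) (dSum_pushTo_lof hκ j hx) := by
  induction j, h using Nat.le_induction with
  | base => simp only [fH_self, LinearMap.id_apply, pushTo_lof_self]
  | succ j h ih =>
    simp only [fH_succ hκ h, LinearMap.comp_apply, ih, inducedHom_homologyClass,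
      pushTo_lof_succ κ h]

lemma inducedHom_iota_succ (hκ : ∀ i, (κ i) ∘ₗ (d i) = (d (i + 1)) ∘ₗ (κ i)) (j : ℕ)
    (z : homologyOf (d j)) :
    inducedHom (d (j + 1)) (Dtel C d κ) (iota C (j + 1)) (iota_chain C d κ (j + 1))
        (inducedHom (d j) (d (j + 1)) (κ j) (hκ j) z) =
      inducedHom (d j) (Dtel C d κ) (iota C j) (iota_chain C d κ j) z := by
  obtain ⟨x, hx, rfl⟩ := exists_homologyClass_eq _ z
  simp only [inducedHom_homologyClass, homologyClass_eq_iff]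
  refine ⟨(0, lof R ℕ C j x), ?_⟩
  simp [Dtel_apply, conn_lof, dSum_lof, hx, iota]

lemma inducedHom_iota_fH (hκ : ∀ i, (κ i) ∘ₗ (d i) = (d (i + 1)) ∘ₗ (κ i)) {i j : ℕ}
    (hij : i ≤ j) (z : homologyOf (d i)) :
    inducedHom (d j) (Dtel C d κ) (iota C j) (iota_chain C d κ j) (fH C d κ hκ i j hij z) =
      inducedHom (d i) (Dtel C d κ) (iota C i) (iota_chain C d κ i) z := by
  induction j, hij using Nat.le_induction with
  | base => rw [fH_self, LinearMap.id_apply]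
  | succ j h ih => rw [fH_succ hκ h, LinearMap.comp_apply, inducedHom_iota_succ, ih]

lemma exists_fH_eq_zero (hκ : ∀ i, (κ i) ∘ₗ (d i) = (d (i + 1)) ∘ₗ (κ i)) (i : ℕ)
    (z : homologyOf (d i))
    (hz : inducedHom (d i) (Dtel C d κ) (iota C i) (iota_chain C d κ i) z = 0) :
    ∃ (n : ℕ) (h : i ≤ n), fH C d κ hκ i n h z = 0 := by
  obtain ⟨x, hx, rfl⟩ := exists_homologyClass_eq _ z
  rw [inducedHom_homologyClass, homologyClass_eq_zero_iff] at hz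
  obtain ⟨⟨a, b⟩, hab⟩ := hz
  have hx' : dSum C d a + conn C κ b = lof R ℕ C i x := congrArg Prod.fst hab
  obtain ⟨N, hN⟩ := exists_component_eq_zero (R := R) b
  refine ⟨max i N, le_max_left i N, ?_⟩
  rw [fH_homologyClass, homologyClass_eq_zero_iff]
  refine ⟨pushTo κ _ a, ?_⟩
  have h1 := LinearMap.congr_fun (pushTo_dSum κ d hκ (max i N)) a
  have h2 := LinearMap.congr_fun (pushTo_conn κ (max i N)) b
  rw [LinearMap.neg_apply, hN _ (le_max_right i N), neg_zero] at h2
  simp only [LinearMap.comp_apply] at h1 h2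
  rw [← hx', map_add, h1, h2, add_zero]

lemma exists_inducedHom_iota_eq (hκ : ∀ i, (κ i) ∘ₗ (d i) = (d (i + 1)) ∘ₗ (κ i))
    (z : homologyOf (Dtel C d κ)) :
    ∃ (n : ℕ) (y : homologyOf (d n)),
      inducedHom (d n) (Dtel C d κ) (iota C n) (iota_chain C d κ n) y = z := by
  obtain ⟨⟨a, b⟩, hab, rfl⟩ := exists_homologyClass_eq _ z
  have ha : dSum C d a + conn C κ b = 0 := congrArg Prod.fst hab
  have hpush (n : ℕ) : d n (pushTo κ n a) = component R ℕ C n b := by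
    have h := congrArg (pushTo κ n) ha
    have h1 := LinearMap.congr_fun (pushTo_dSum κ d hκ n) a
    have h2 := LinearMap.congr_fun (pushTo_conn κ n) b
    simp only [LinearMap.comp_apply, LinearMap.neg_apply] at h1 h2
    rwa [map_add, map_zero, h1, h2, ← sub_eq_add_neg, sub_eq_zero] at h
  obtain ⟨M, hM⟩ := exists_component_eq_zero (R := R) a
  obtain ⟨N, hN⟩ := exists_component_eq_zero (R := R) b
  set n := max M N
  have hb : dSum C d (∑ k ∈ Finset.range n, lof R ℕ C k (pushTo κ k a)) = b := by
    simp only [map_sum, dSum_lof, hpush]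
    exact sum_lof_component b n fun k hk => hN k ((le_max_right M N).trans hk)
  have hc := sum_lof_component_add_conn κ a n
  rw [sum_lof_component a (n + 1) fun k hk => hM k (by omega)] at hc
  refine ⟨n, homologyClass (d n) (pushTo κ n a) (by rw [hpush, hN n (le_max_right M N)]), ?_⟩
  rw [inducedHom_homologyClass, homologyClass_eq_iff]
  refine ⟨(0, ∑ k ∈ Finset.range n, lof R ℕ C k (pushTo κ k a)), ?_⟩
  rw [Dtel_apply, hb]
  simp [iota, ← hc]

end TelescopeHomology

/-- The telescope differential squares to zero, and the homology of the
telescope is isomorphic to the direct limit of the homologies `H(C_i, d_i)` along the maps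
induced by `κ_i`; the isomorphism is induced by the inclusions of the `C_i` into the first
direct summand of the telescope. -/
theorem telescope_homology_iso_directLimit
    (d : ∀ i, C i →ₗ[R] C i) (hd : ∀ i, (d i) ∘ₗ (d i) = 0)
    (κ : ∀ i, C i →ₗ[R] C (i + 1))
    (hκ : ∀ i, (κ i) ∘ₗ (d i) = (d (i + 1)) ∘ₗ (κ i)) :
    (Dtel C d κ) ∘ₗ (Dtel C d κ) = 0 ∧
    ∃ hcompat : ∀ (i j : ℕ) (hij : i ≤ j) (x : homologyOf (d i)),
        inducedHom (d j) (Dtel C d κ) (iota C j) (iota_chain C d κ j)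
            (fH C d κ hκ i j hij x) =
          inducedHom (d i) (Dtel C d κ) (iota C i) (iota_chain C d κ i) x,
      Function.Bijective
        (Module.DirectLimit.lift R ℕ (fun i => homologyOf (d i)) (fH C d κ hκ)
          (fun i => inducedHom (d i) (Dtel C d κ) (iota C i) (iota_chain C d κ i))
          hcompat) := by
  refine ⟨Dtel_comp_Dtel hd hκ, fun i j hij x => inducedHom_iota_fH hκ hij x, ?_, ?_⟩
  · refine (injective_iff_map_eq_zero _).2 fun z hz => ?_
    obtain ⟨i, y, rfl⟩ := Module.DirectLimit.exists_of z
    rw [Module.DirectLimit.lift_of] at hz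
    obtain ⟨n, h, hn⟩ := exists_fH_eq_zero hκ i y hz
    rw [← Module.DirectLimit.of_f (hij := h), hn, map_zero]
  · intro z
    obtain ⟨n, y, rfl⟩ := exists_inducedHom_iota_eq hκ z
    exact ⟨Module.DirectLimit.of R ℕ _ _ n y, Module.DirectLimit.lift_of _ _ _⟩

end Telescope
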